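/- arXiv:1103.4600 — 2 statements merged into one kernel-verified Lean document; each statement's English description precedes it below -/
import Mathlib

section
/- Let S = S₁ × ⋯ × Sₙ ⊆ ℂⁿ be a polysector, and let f : closure(S) → ℂ be continuous on closure(S) and holomorphic in S. If a = (a₂,…,aₙ) belongs to the distinguished boundary ∂_d(S₂ × ⋯ × Sₙ) (i.e. a_j ∈ ∂S_j for every j = 2,…,n), then the function f_a : S₁ → ℂ defined by f_a(z) = f(z, a₂,…,aₙ) is holomorphic in S₁ (and continuous on closure(S₁)). -/
open Complex Set
open scoped ENNReal

noncomputable section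

/-- The open sector `S(a,b;ρ)` of the complex plane. -/
def Sector (a b : ℝ) (ρ : ℝ≥0∞) : Set ℂ :=
  {z : ℂ | ∃ r θ : ℝ, 0 < r ∧ ENNReal.ofReal r < ρ ∧ a < θ ∧ θ < b ∧
    z = (r : ℂ) * Complex.exp ((θ : ℂ) * Complex.I)}

theorem sector_eq_image_exp (a b : ℝ) (ρ : ℝ≥0∞) :
    Sector a b ρ =
      Complex.exp '' {w : ℂ | ENNReal.ofReal (Real.exp w.re) < ρ ∧ a < w.im ∧ w.im < b} := by
  ext z
  constructor
  · rintro ⟨r, θ, hr, hrρ, haθ, hθb, rfl⟩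
    refine ⟨⟨Real.log r, θ⟩, ⟨by simpa [Real.exp_log hr] using hrρ, haθ, hθb⟩, ?_⟩
    rw [← Complex.re_add_im ⟨Real.log r, θ⟩, Complex.exp_add, ← Complex.ofReal_exp,
      Real.exp_log hr]
  · rintro ⟨w, ⟨hwρ, haw, hwb⟩, rfl⟩
    refine ⟨Real.exp w.re, w.im, Real.exp_pos _, hwρ, haw, hwb, ?_⟩
    rw [Complex.ofReal_exp, ← Complex.exp_add, Complex.re_add_im]

theorem isOpen_sector (a b : ℝ) (ρ : ℝ≥0∞) : IsOpen (Sector a b ρ) := by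
  rw [sector_eq_image_exp]
  refine Complex.isOpenMap_exp _ (IsOpen.inter ?_ (IsOpen.inter ?_ ?_))
  · exact isOpen_lt (ENNReal.continuous_ofReal.comp
      (Real.continuous_exp.comp Complex.continuous_re)) continuous_const
  · exact isOpen_lt continuous_const Complex.continuous_im
  · exact isOpen_lt Complex.continuous_im continuous_const

/-- Freezing the last variables of a function holomorphic on `U × T` and continuous up to
`U × closure T` at a point of `closure T` gives a holomorphic function on `U`. -/
theorem differentiableOn_of_continuousOn_prod_closure {α : Type*} [TopologicalSpace α]
    {g : α → ℂ → ℂ} {T : Set α} {U : Set ℂ} {p : α} (hU : IsOpen U) (hp : p ∈ closure T)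
    (hg : ContinuousOn (Function.uncurry g) (closure T ×ˢ U))
    (hd : ∀ q ∈ T, DifferentiableOn ℂ (g q) U) : DifferentiableOn ℂ (g p) U := by
  have : (nhdsWithin p T).NeBot := mem_closure_iff_nhdsWithin_neBot.1 hp
  have hlim : TendstoLocallyUniformlyOn g (g p) (nhdsWithin p T) U := by
    rw [tendstoLocallyUniformlyOn_iff_forall_isCompact hU]
    intro K hKU hK u hu
    obtain ⟨v, hv, hvu⟩ := hK.mem_uniformity_of_prod
      (hg.mono (prod_mono_right hKU)) hp (symm_le_uniformity hu)
    filter_upwards [nhdsWithin_mono p subset_closure hv] with q hq x hx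
    exact hvu q hq x hx
  exact hlim.differentiableOn (eventually_mem_nhdsWithin.mono hd) hU

/-- if `f` is continuous on the closure of a polysector
`S = S₁ × ⋯ × S_{n+1}` and holomorphic in `S`, and `A` belongs to the distinguished
boundary of `S₂ × ⋯ × S_{n+1}`, then `z ↦ f (z, A)` is holomorphic in `S₁` and
continuous on `closure S₁`. -/
theorem restriction_to_distinguished_boundary_is_holomorphic
    (n : ℕ) (a b : Fin (n + 1) → ℝ) (ρ : Fin (n + 1) → ℝ≥0∞)
    (hab : ∀ j, a j < b j) (hρ : ∀ j, 0 < ρ j)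
    (S : Fin (n + 1) → Set ℂ) (hS : ∀ j, S j = Sector (a j) (b j) (ρ j))
    (f : (Fin (n + 1) → ℂ) → ℂ)
    (hf_cont : ContinuousOn f (closure (univ.pi S)))
    (hf_holo : DifferentiableOn ℂ f (univ.pi S))
    (A : Fin n → ℂ)
    (hA : ∀ i : Fin n, A i ∈ frontier (S i.succ)) :
    DifferentiableOn ℂ (fun z : ℂ => f (Fin.cons z A)) (S 0) ∧
      ContinuousOn (fun z : ℂ => f (Fin.cons z A)) (closure (S 0)) := by
  have hA' : A ∈ closure (univ.pi fun i : Fin n => S i.succ) := by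
    rw [closure_pi_set]
    exact fun i _ => frontier_subset_closure (hA i)
  have hcont : ContinuousOn (Function.uncurry fun (q : Fin n → ℂ) (z : ℂ) => f (Fin.cons z q))
      (closure (univ.pi fun i : Fin n => S i.succ) ×ˢ closure (S 0)) := by
    have hcons : Continuous fun x : (Fin n → ℂ) × ℂ =>
        (Fin.cons x.2 x.1 : Fin (n + 1) → ℂ) :=
      Continuous.finCons (A := fun _ : Fin (n + 1) => ℂ) continuous_snd continuous_fst
    refine hf_cont.comp hcons.continuousOn ?_
    rintro ⟨q, z⟩ ⟨hq, hz⟩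
    rw [closure_pi_set] at hq ⊢
    exact fun j _ => Fin.cases hz (fun i => hq i (mem_univ i)) j
  have hS0 : IsOpen (S 0) := hS 0 ▸ isOpen_sector _ _ _
  constructor
  · refine differentiableOn_of_continuousOn_prod_closure
      (g := fun (q : Fin n → ℂ) (z : ℂ) => f (Fin.cons z q)) hS0 hA'
      (hcont.mono (prod_mono_right subset_closure)) fun q hq => ?_
    have hcons : DifferentiableOn ℂ (fun z : ℂ => (Fin.cons z q : Fin (n + 1) → ℂ)) (S 0) :=
      DifferentiableOn.finCons (F' := fun _ => ℂ) differentiableOn_id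
        (differentiableOn_const q)
    exact hf_holo.comp hcons fun z hz j _ => Fin.cases hz (fun i => hq i (mem_univ i)) j
  · exact hcont.comp (f := fun z : ℂ => (A, z)) (by fun_prop) fun z hz => ⟨hA', hz⟩

end
end

section
/- Let E be a complex Banach space, S = S(α,β;ρ) ⊆ ℂⁿ a polysector, and for each j = 1,…,n let R_j : (α_j,β_j) → (0,∞) be a function with inf_{θ_j∈K} R_j(θ_j) > 0 for every compact K ⊂ (α_j,β_j). Then the space W¹_{R(θ)}(S,E) of holomorphic functions f : S → E with ‖f‖_{R(θ)} := sup{ ‖D^N f(z)‖_E · ∏_j R_j(arg z_j)^{N_j} / (N!)² : z ∈ S, N ∈ ℕ₀ⁿ } < ∞, equipped with the norm ‖·‖_{R(θ)}, is a Banach space (i.e. it is complete). -/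
open Complex Set
open scoped ENNReal

noncomputable section

/-- The point of polar coordinates `(r j, θ j)` in each component. -/
def PolarPt {n : ℕ} (r θ : Fin n → ℝ) : Fin n → ℂ :=
  fun j => (r j : ℂ) * Complex.exp ((θ j : ℂ) * Complex.I)

/-- Partial derivative of `f` with respect to the `j`-th coordinate. -/
def pDeriv {ι : Type*} [DecidableEq ι] {E : Type*} [NormedAddCommGroup E]
    [NormedSpace ℂ E] (j : ι) (f : (ι → ℂ) → E) : (ι → ℂ) → E :=
  fun z => deriv (fun w : ℂ => f (Function.update z j w)) (z j)

/-- Iterated partial derivative `D^N f` for a multi-index `N`. -/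
def DMulti {ι : Type*} [Fintype ι] [DecidableEq ι] {E : Type*} [NormedAddCommGroup E]
    [NormedSpace ℂ E] (N : ι → ℕ) (f : (ι → ℂ) → E) : (ι → ℂ) → E :=
  (Finset.univ : Finset ι).toList.foldr (fun j g => (pDeriv j)^[N j] g) f

/-- `WBound a b ρ R f C` expresses that the `W¹_{R(θ)}`-norm of `f` on the polysector
`∏ⱼ S(a j, b j; ρ j)` is at most `C`, i.e.
`‖D^N f(z)‖ ∏ⱼ R j (arg z j)^(N j) ≤ C (N!)²` for every `z` in the polysector
(written in polar coordinates `z j = r j e^{i θ j}`, `a j < θ j < b j`) and every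
multi-index `N`. -/
def WBound {n : ℕ} (a b : Fin n → ℝ) (ρ : Fin n → ℝ≥0∞) (R : Fin n → ℝ → ℝ)
    {E : Type*} [NormedAddCommGroup E] [NormedSpace ℂ E]
    (f : (Fin n → ℂ) → E) (C : ℝ) : Prop :=
  ∀ (θ r : Fin n → ℝ) (N : Fin n → ℕ),
    (∀ j, a j < θ j ∧ θ j < b j ∧ 0 < r j ∧ ENNReal.ofReal (r j) < ρ j) →
    ‖DMulti N f (PolarPt r θ)‖ * ∏ j, R j (θ j) ^ N j ≤
      C * (∏ j, ((N j).factorial : ℝ)) ^ 2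

open Filter Topology Metric in
/-- Cauchy's estimate for the Fréchet derivative. -/
theorem norm_fderiv_le_of_forall_mem_ball_norm_le
    {V E : Type*} [NormedAddCommGroup V] [NormedSpace ℂ V]
    [NormedAddCommGroup E] [NormedSpace ℂ E] {f : V → E} {z : V} {s r C : ℝ} (hs : 0 < s)
    (hsr : s < r) (hC : 0 ≤ C) (hf : DifferentiableOn ℂ f (ball z r))
    (hb : ∀ x ∈ ball z r, ‖f x‖ ≤ C) : ‖fderiv ℂ f z‖ ≤ C / s := by
  refine ContinuousLinearMap.opNorm_le_bound _ (by positivity) fun v => ?_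
  rcases eq_or_ne v 0 with rfl | hv
  · simp
  have hv' : 0 < ‖v‖ := norm_pos_iff.2 hv
  have hmem : ∀ t ∈ closedBall (0 : ℂ) (s / ‖v‖), z + t • v ∈ ball z r := by
    intro t ht
    rw [mem_closedBall_zero_iff, le_div_iff₀ hv'] at ht
    rw [mem_ball_iff_norm, add_sub_cancel_left, norm_smul]
    exact ht.trans_lt hsr
  have hd : DifferentiableOn ℂ (fun t : ℂ => f (z + t • v)) (closedBall 0 (s / ‖v‖)) :=
    hf.comp (by fun_prop) hmem
  have h1 := Complex.norm_deriv_le_of_forall_mem_sphere_norm_le (div_pos hs hv')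
    (hd.diffContOnCl_ball subset_rfl) (C := C)
    fun t ht => hb _ (hmem t (sphere_subset_closedBall ht))
  have h2 : HasDerivAt (fun t : ℂ => f (z + t • v)) (fderiv ℂ f z v) 0 := by
    have hfz : HasFDerivAt f (fderiv ℂ f z) (z + (0 : ℂ) • v) := by
      simpa using (hf.differentiableAt (ball_mem_nhds z (hs.trans hsr))).hasFDerivAt
    have hl : HasDerivAt (fun t : ℂ => z + t • v) v 0 := by
      simpa using ((hasDerivAt_id (0 : ℂ)).smul_const v).const_add z
    exact hfz.comp_hasDerivAt (0 : ℂ) hl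
  rw [h2.deriv] at h1
  convert h1 using 1
  field_simp

open Filter Topology Metric in
/-- A uniform limit of holomorphic maps on an open subset of a complex normed space is
holomorphic. -/
theorem TendstoUniformlyOn.differentiableOn_complex
    {V E : Type*} [NormedAddCommGroup V] [NormedSpace ℂ V]
    [NormedAddCommGroup E] [NormedSpace ℂ E] [CompleteSpace E] {F : ℕ → V → E} {f : V → E}
    {U : Set V} (hU : IsOpen U) (hF : ∀ k, DifferentiableOn ℂ (F k) U)
    (h : TendstoUniformlyOn F f atTop U) : DifferentiableOn ℂ f U := by
  intro z hz
  obtain ⟨r, hr, hrU⟩ := Metric.isOpen_iff.1 hU z hz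
  have hsub : ball z (r / 2) ⊆ U := (ball_subset_ball (by linarith)).trans hrU
  have hC : UniformCauchySeqOn (fun k => fderiv ℂ (F k)) atTop (ball z (r / 2)) := by
    rw [Metric.uniformCauchySeqOn_iff]
    intro ε hε
    obtain ⟨K, hK⟩ := Metric.uniformCauchySeqOn_iff.1 h.uniformCauchySeqOn (ε * (r / 8))
      (by positivity)
    refine ⟨K, fun k hk l hl x hx => ?_⟩
    have hxU : ball x (r / 2) ⊆ U := by
      refine (ball_subset_ball' ?_).trans hrU
      rw [mem_ball] at hx
      linarith
    have hat : ∀ k, DifferentiableAt ℂ (F k) x := fun k =>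
      (hF k).differentiableAt (hU.mem_nhds (hsub hx))
    have hle := norm_fderiv_le_of_forall_mem_ball_norm_le (f := F k - F l) (z := x)
      (s := r / 4) (r := r / 2) (C := ε * (r / 8)) (by positivity) (by linarith) (by positivity)
      (((hF k).sub (hF l)).mono hxU) fun y hy => by
        simpa [dist_eq_norm] using (hK k hk l hl y (hxU hy)).le
    rw [fderiv_sub (hat k) (hat l)] at hle
    rw [dist_eq_norm]
    refine hle.trans_lt ?_
    rw [div_lt_iff₀ (by positivity)]
    nlinarith [mul_pos hε hr]
  choose! G hG using fun x (hx : x ∈ ball z (r / 2)) => cauchySeq_tendsto_of_complete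
    (hC.cauchySeq hx)
  exact (hasFDerivAt_of_tendstoUniformlyOn isOpen_ball (hC.tendstoUniformlyOn_of_tendsto hG)
    (fun k x hx => ((hF k).differentiableAt (hU.mem_nhds (hsub hx))).hasFDerivAt)
    (fun x hx => h.tendsto_at (hsub hx))
    (mem_ball_self (by positivity))).differentiableAt.differentiableWithinAt

open Filter Topology Metric in
/-- Uniform convergence of holomorphic maps on a ball implies uniform convergence of their
derivatives on the ball of half the radius. -/
theorem TendstoUniformlyOn.fderiv_complex
    {V E : Type*} [NormedAddCommGroup V] [NormedSpace ℂ V]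
    [NormedAddCommGroup E] [NormedSpace ℂ E] [CompleteSpace E] {F : ℕ → V → E} {f : V → E}
    {z : V} {r : ℝ} (hr : 0 < r) (hF : ∀ k, DifferentiableOn ℂ (F k) (ball z r))
    (h : TendstoUniformlyOn F f atTop (ball z r)) :
    TendstoUniformlyOn (fun k => fderiv ℂ (F k)) (fderiv ℂ f) atTop (ball z (r / 2)) := by
  have hf := h.differentiableOn_complex isOpen_ball hF
  rw [Metric.tendstoUniformlyOn_iff] at h ⊢
  intro ε hε
  filter_upwards [h (ε * (r / 8)) (by positivity)] with k hk x hx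
  have hxz : ball x (r / 2) ⊆ ball z r := by
    refine ball_subset_ball' ?_
    rw [mem_ball] at hx
    linarith
  have hx' : ball z r ∈ 𝓝 x := isOpen_ball.mem_nhds (hxz (mem_ball_self (by positivity)))
  have hle := norm_fderiv_le_of_forall_mem_ball_norm_le (f := f - F k) (z := x)
    (s := r / 4) (r := r / 2) (C := ε * (r / 8)) (by positivity) (by linarith) (by positivity)
    ((hf.sub (hF k)).mono hxz) fun y hy => by
      simpa [dist_eq_norm] using (hk y (hxz hy)).le
  rw [fderiv_sub (hf.differentiableAt hx') ((hF k).differentiableAt hx')] at hle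
  rw [dist_eq_norm]
  refine hle.trans_lt ?_
  rw [div_lt_iff₀ (by positivity)]
  nlinarith [mul_pos hε hr]

open Filter Topology Metric in
/-- Directional derivatives of a holomorphic map are holomorphic. -/
theorem DifferentiableOn.fderiv_apply_complex
    {V E : Type*} [NormedAddCommGroup V] [NormedSpace ℂ V]
    [NormedAddCommGroup E] [NormedSpace ℂ E] [CompleteSpace E] {f : V → E}
    {U : Set V} (hU : IsOpen U) (hf : DifferentiableOn ℂ f U) (v : V) :
    DifferentiableOn ℂ (fun z => fderiv ℂ f z v) U := by
  intro z hz
  -- `f` is bounded by `C` on a ball of radius `4 * r`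
  obtain ⟨r, hr, hrU, C, hC0, hC⟩ : ∃ r > 0, ball z (4 * r) ⊆ U ∧
      ∃ C : ℝ, 0 < C ∧ ∀ x ∈ ball z (4 * r), ‖f x‖ ≤ C := by
    have hc : ContinuousAt f z := (hf.differentiableAt (hU.mem_nhds hz)).continuousAt
    have h1 : ∀ᶠ x in 𝓝 z, ‖f x‖ < ‖f z‖ + 1 :=
      hc.norm.eventually (gt_mem_nhds (lt_add_one _))
    obtain ⟨s, hs, hsub⟩ := Metric.mem_nhds_iff.1 (inter_mem h1 (hU.mem_nhds hz))
    refine ⟨s / 4, by positivity, ?_, ‖f z‖ + 1, by positivity, ?_⟩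
    · rw [mul_div_cancel₀ _ (by norm_num)]
      exact fun x hx => (hsub hx).2
    · rw [mul_div_cancel₀ _ (by norm_num)]
      exact fun x hx => (hsub hx).1.le
  have hat : ∀ x ∈ ball z (4 * r), DifferentiableAt ℂ f x := fun x hx =>
    hf.differentiableAt (hU.mem_nhds (hrU hx))
  have hadd : ∀ {s t : ℝ} {x w : V}, x ∈ ball z s → ‖w‖ ≤ t → x + w ∈ ball z (s + t) := by
    intro s t x w hx hw
    rw [mem_ball_iff_norm] at hx ⊢
    calc ‖x + w - z‖ = ‖(x - z) + w‖ := by congr 1; abel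
      _ ≤ ‖x - z‖ + ‖w‖ := norm_add_le _ _
      _ < s + t := by linarith
  -- hence `f` is Lipschitz on the ball of radius `3 * r`
  set L : ℝ := C / (r / 2) with hL
  have hL0 : 0 < L := by positivity
  have hlip : ∀ x ∈ ball z (3 * r), ∀ y ∈ ball z (3 * r), ‖f y - f x‖ ≤ L * ‖y - x‖ := by
    have hsub : ball z (3 * r) ⊆ ball z (4 * r) := ball_subset_ball (by linarith)
    have hb : ∀ x ∈ ball z (3 * r), ‖fderiv ℂ f x‖ ≤ L := by
      intro x hx
      have hx4 : ball x r ⊆ ball z (4 * r) := by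
        refine ball_subset_ball' ?_
        rw [mem_ball] at hx
        linarith
      exact norm_fderiv_le_of_forall_mem_ball_norm_le (by positivity) (by linarith) hC0.le
        (hf.mono (hx4.trans hrU)) fun y hy => hC y (hx4 hy)
    let _ : NormedSpace ℝ V := NormedSpace.restrictScalars ℝ ℂ V
    intro x hx y hy
    exact (convex_ball z (3 * r)).norm_image_sub_le_of_norm_fderiv_le
      (fun x hx => hat x (hsub hx)) hb hx hy
  -- and so is its derivative on the ball of radius `r`
  set M : ℝ := L / (r / 2) with hM
  have hM0 : 0 < M := by positivity
  have hderiv : ∀ x ∈ ball z r, ∀ w : V, ‖w‖ ≤ r →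
      ‖fderiv ℂ f (x + w) - fderiv ℂ f x‖ ≤ M * ‖w‖ := by
    intro x hx w hw
    have hx2 : ∀ y ∈ ball x r, y ∈ ball z (2 * r) := by
      intro y hy
      refine ball_subset_ball' ?_ hy
      rw [mem_ball] at hx
      linarith
    have hshift : ∀ y ∈ ball x r, y + w ∈ ball z (3 * r) := by
      intro y hy
      convert hadd (hx2 y hy) hw using 2
      ring
    have h34 : ball z (3 * r) ⊆ ball z (4 * r) := ball_subset_ball (by linarith)
    have h23 : ball z (2 * r) ⊆ ball z (3 * r) := ball_subset_ball (by linarith)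
    have hd1 : DifferentiableOn ℂ (fun y => f (y + w)) (ball x r) :=
      hf.comp (by fun_prop) fun y hy => hrU (h34 (hshift y hy))
    have hle := norm_fderiv_le_of_forall_mem_ball_norm_le
      (f := fun y => f (y + w) - f y) (z := x) (s := r / 2) (r := r) (C := L * ‖w‖)
      (by positivity) (by linarith) (by positivity)
      (hd1.sub (hf.mono fun y hy => hrU (h34 (h23 (hx2 y hy)))))
      fun y hy => by
        simpa using hlip y (h23 (hx2 y hy)) (y + w) (hshift y hy)
    have hxx : x ∈ ball x r := mem_ball_self hr
    rw [fderiv_fun_sub (hd1.differentiableAt (isOpen_ball.mem_nhds hxx))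
      (hat x (h34 (h23 (hx2 x hxx)))), fderiv_comp_add_right] at hle
    refine hle.trans_eq ?_
    rw [hM]
    ring
  -- so the difference quotients converge uniformly
  have htaylor : ∀ x ∈ ball z r, ∀ w : V, ‖w‖ ≤ r →
      ‖f (x + w) - f x - fderiv ℂ f x w‖ ≤ M * ‖w‖ * ‖w‖ := by
    intro x hx w hw
    let _ : NormedSpace ℝ V := NormedSpace.restrictScalars ℝ ℂ V
    have hmem : ∀ y ∈ closedBall x ‖w‖, ‖y - x‖ ≤ ‖w‖ := fun y hy => by
      rwa [mem_closedBall_iff_norm] at hy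
    have h := (convex_closedBall x ‖w‖).norm_image_sub_le_of_norm_fderiv_le' (𝕜 := ℂ) (f := f)
      (φ := fderiv ℂ f x) (C := M * ‖w‖) (x := x) (y := x + w)
      (fun y hy => hat y (by
        have := hadd hx ((hmem y hy).trans hw)
        rw [add_sub_cancel] at this
        exact ball_subset_ball (by linarith) this))
      (fun y hy => by
        have := hderiv x hx (y - x) ((hmem y hy).trans hw)
        rw [add_sub_cancel] at this
        exact this.trans (mul_le_mul_of_nonneg_left (hmem y hy) hM0.le))
      (mem_closedBall_self (norm_nonneg w)) (by simp)
    simpa using h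
  set c : ℕ → ℝ := fun m => r / (‖v‖ + 1) / (m + 1) with hc
  have hc0 : ∀ m, 0 < c m := fun m => by positivity
  have hcv : ∀ m, ‖(c m : ℂ) • v‖ ≤ r := by
    intro m
    rw [norm_smul, norm_real, Real.norm_of_nonneg (hc0 m).le]
    have h1 : c m ≤ r / (‖v‖ + 1) := div_le_self (by positivity) (by simp)
    calc c m * ‖v‖ ≤ r / (‖v‖ + 1) * (‖v‖ + 1) := by gcongr; simp
      _ = r := by field_simp
  have hclim : Tendsto c atTop (𝓝 0) := by
    simpa [hc, div_eq_mul_inv] using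
      (tendsto_one_div_add_atTop_nhds_zero_nat (𝕜 := ℝ)).const_mul (r / (‖v‖ + 1))
  refine DifferentiableAt.differentiableWithinAt ?_
  refine DifferentiableOn.differentiableAt (s := ball z r) ?_ (ball_mem_nhds z hr)
  refine TendstoUniformlyOn.differentiableOn_complex
    (F := fun m x => (c m : ℂ)⁻¹ • (f (x + (c m : ℂ) • v) - f x)) isOpen_ball ?_ ?_
  · intro m x hx
    refine DifferentiableAt.differentiableWithinAt ?_
    have h1 : DifferentiableAt ℂ f (x + (c m : ℂ) • v) :=
      hat _ (ball_subset_ball (by linarith) (hadd hx (hcv m)))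
    have h2 : DifferentiableAt ℂ f x := hat _ (ball_subset_ball (by linarith) hx)
    exact ((h1.comp x (f := fun y => y + (c m : ℂ) • v) (by fun_prop)).sub h2).const_smul _
  · rw [Metric.tendstoUniformlyOn_iff]
    intro ε hε
    have hlim : Tendsto (fun m => c m * (M * ‖v‖ * ‖v‖)) atTop (𝓝 0) := by
      simpa using hclim.mul_const (M * ‖v‖ * ‖v‖)
    filter_upwards [hlim.eventually (gt_mem_nhds hε)] with m hm x hx
    have hcne : (c m : ℂ) ≠ 0 := by exact_mod_cast (hc0 m).ne'
    have h := htaylor x hx _ (hcv m)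
    rw [dist_comm, dist_eq_norm]
    have heq : (c m : ℂ)⁻¹ • (f (x + (c m : ℂ) • v) - f x) - fderiv ℂ f x v =
        (c m : ℂ)⁻¹ • (f (x + (c m : ℂ) • v) - f x - fderiv ℂ f x ((c m : ℂ) • v)) := by
      rw [map_smul, smul_sub _ _ ((c m : ℂ) • _), inv_smul_smul₀ hcne]
    rw [heq, norm_smul, norm_inv, norm_real, Real.norm_of_nonneg (hc0 m).le]
    refine lt_of_le_of_lt ?_ hm
    rw [inv_mul_le_iff₀ (hc0 m)]
    refine h.trans_eq ?_
    rw [norm_smul, norm_real, Real.norm_of_nonneg (hc0 m).le]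
    ring

/-- At a point of differentiability, `pDeriv j f` is a directional derivative. -/
theorem pDeriv_eq_fderiv {ι : Type*} [Fintype ι] [DecidableEq ι] {E : Type*}
    [NormedAddCommGroup E] [NormedSpace ℂ E] {f : (ι → ℂ) → E} {z : ι → ℂ}
    (hf : DifferentiableAt ℂ f z) (j : ι) : pDeriv j f z = fderiv ℂ f z (Pi.single j 1) := by
  have h : HasFDerivAt f (fderiv ℂ f z) (Function.update z j (z j)) := by
    simpa using hf.hasFDerivAt
  exact (h.comp_hasDerivAt (z j) (hasDerivAt_update z j (z j))).deriv

theorem DifferentiableOn.pDeriv {ι : Type*} [Fintype ι] [DecidableEq ι] {E : Type*}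
    [NormedAddCommGroup E] [NormedSpace ℂ E] [CompleteSpace E] {f : (ι → ℂ) → E}
    {U : Set (ι → ℂ)} (hU : IsOpen U) (hf : DifferentiableOn ℂ f U) (j : ι) :
    DifferentiableOn ℂ (pDeriv j f) U :=
  (hf.fderiv_apply_complex hU _).congr fun _ hz =>
    pDeriv_eq_fderiv (hf.differentiableAt (hU.mem_nhds hz)) j

/-- A property of families of functions that is stable under componentwise partial derivatives is
stable under componentwise iterated partial derivatives. -/
theorem DMulti_induction {ι I : Type*} [Fintype ι] [DecidableEq ι] {E : Type*}
    [NormedAddCommGroup E] [NormedSpace ℂ E] {P : (I → (ι → ℂ) → E) → Prop}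
    (hP : ∀ j f, P f → P fun i => pDeriv j (f i)) (N : ι → ℕ) {f : I → (ι → ℂ) → E} (hf : P f) :
    P fun i => DMulti N (f i) := by
  have hiter : ∀ (j : ι) (m : ℕ) f, P f → P fun i => (pDeriv j)^[m] (f i) := by
    intro j m
    induction m with
    | zero => exact fun f hf => hf
    | succ m ih => exact fun f hf => ih _ (hP j f hf)
  unfold DMulti
  induction (Finset.univ : Finset ι).toList with
  | nil => exact hf
  | cons j l ih => exact hiter j (N j) _ ih

open Filter Topology Metric in
/-- Under uniform convergence of holomorphic functions on an open set, all iterated partial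
derivatives converge pointwise. -/
theorem TendstoUniformlyOn.tendsto_DMulti {ι : Type*} [Fintype ι] [DecidableEq ι] {E : Type*}
    [NormedAddCommGroup E] [NormedSpace ℂ E] [CompleteSpace E] {F : ℕ → (ι → ℂ) → E}
    {f : (ι → ℂ) → E} {U : Set (ι → ℂ)} (hU : IsOpen U) (hF : ∀ k, DifferentiableOn ℂ (F k) U)
    (h : TendstoUniformlyOn F f atTop U) (N : ι → ℕ) {z : ι → ℂ} (hz : z ∈ U) :
    Tendsto (fun k => DMulti N (F k) z) atTop (𝓝 (DMulti N f z)) := by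
  let P : (Option ℕ → (ι → ℂ) → E) → Prop := fun G =>
    (∀ i, DifferentiableOn ℂ (G i) U) ∧
      ∀ z ∈ U, ∃ t ∈ 𝓝 z, TendstoUniformlyOn (fun k => G (some k)) (G none) atTop t
  have hP : ∀ j G, P G → P fun i => pDeriv j (G i) := by
    rintro j G ⟨hd, hc⟩
    refine ⟨fun i => (hd i).pDeriv hU j, fun z hz => ?_⟩
    obtain ⟨t, ht, htc⟩ := hc z hz
    obtain ⟨r, hr, hrt⟩ := Metric.mem_nhds_iff.1 (inter_mem ht (hU.mem_nhds hz))
    have hrU : ball z r ⊆ U := hrt.trans inter_subset_right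
    have hsub : ball z (r / 2) ⊆ U := (ball_subset_ball (by linarith)).trans hrU
    refine ⟨ball z (r / 2), ball_mem_nhds z (by positivity), ?_⟩
    have hlim := (htc.mono (hrt.trans inter_subset_left)).fderiv_complex hr
      fun k => (hd (some k)).mono hrU
    have hev := (ContinuousLinearMap.apply ℂ E
      (Pi.single j 1 : ι → ℂ)).uniformContinuous.comp_tendstoUniformlyOn hlim
    have heq : ∀ i, ∀ x ∈ ball z (r / 2),
        fderiv ℂ (G i) x (Pi.single j 1) = pDeriv j (G i) x := fun i x hx =>
      (pDeriv_eq_fderiv ((hd i).differentiableAt (hU.mem_nhds (hsub hx))) j).symm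
    exact (hev.congr (Eventually.of_forall fun k x hx => heq (some k) x hx)).congr_right
      fun x hx => heq none x hx
  have h0 : P fun i => i.elim f F := by
    refine ⟨fun i => ?_, fun z hz => ⟨U, hU.mem_nhds hz, h⟩⟩
    cases i with
    | none => exact h.differentiableOn_complex hU hF
    | some k => exact hF k
  obtain ⟨t, ht, htc⟩ := (DMulti_induction hP N h0).2 z hz
  exact htc.tendsto_at (mem_of_mem_nhds ht)

open Filter Topology in
theorem DMulti_sub {ι : Type*} [Fintype ι] [DecidableEq ι] {E : Type*}
    [NormedAddCommGroup E] [NormedSpace ℂ E] [CompleteSpace E] {f g : (ι → ℂ) → E}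
    {U : Set (ι → ℂ)} (hU : IsOpen U) (hf : DifferentiableOn ℂ f U)
    (hg : DifferentiableOn ℂ g U) (N : ι → ℕ) {z : ι → ℂ} (hz : z ∈ U) :
    DMulti N (f - g) z = DMulti N f z - DMulti N g z := by
  let P : (Fin 3 → (ι → ℂ) → E) → Prop := fun G =>
    DifferentiableOn ℂ (G 1) U ∧ DifferentiableOn ℂ (G 2) U ∧ EqOn (G 0) (G 1 - G 2) U
  have hP : ∀ j G, P G → P fun i => pDeriv j (G i) := by
    rintro j G ⟨h1, h2, h0⟩
    refine ⟨h1.pDeriv hU j, h2.pDeriv hU j, fun z hz => ?_⟩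
    have hU' := hU.mem_nhds hz
    have hd1 := h1.differentiableAt hU'
    have hd2 := h2.differentiableAt hU'
    have he : G 0 =ᶠ[𝓝 z] G 1 - G 2 := h0.eventuallyEq_of_mem hU'
    have hd0 : DifferentiableAt ℂ (G 0) z := (hd1.sub hd2).congr_of_eventuallyEq he
    simp [pDeriv_eq_fderiv hd0, pDeriv_eq_fderiv hd1, pDeriv_eq_fderiv hd2, he.fderiv_eq,
      fderiv_sub hd1 hd2]
  have h0 : P ![f - g, f, g] := ⟨hf, hg, fun _ _ => rfl⟩
  exact (DMulti_induction hP N h0).2.2 hz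

theorem DMulti_zero {ι : Type*} [Fintype ι] [DecidableEq ι] {E : Type*}
    [NormedAddCommGroup E] [NormedSpace ℂ E] (f : (ι → ℂ) → E) : DMulti 0 f = f := by
  simp [DMulti]

/-- A function with finite weighted norm is bounded by that norm on the polysector. -/
theorem WBound.norm_le {n : ℕ} {a b : Fin n → ℝ} {ρ : Fin n → ℝ≥0∞} {R : Fin n → ℝ → ℝ}
    {E : Type*} [NormedAddCommGroup E] [NormedSpace ℂ E] {f : (Fin n → ℂ) → E} {C : ℝ}
    (h : WBound a b ρ R f C) {z : Fin n → ℂ}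
    (hz : z ∈ univ.pi fun j => Sector (a j) (b j) (ρ j)) : ‖f z‖ ≤ C := by
  choose r θ hr hrρ ha hb hz using fun j => hz j (mem_univ j)
  obtain rfl : z = PolarPt r θ := funext hz
  simpa [DMulti_zero] using h θ r 0 fun j => ⟨ha j, hb j, hr j, hrρ j⟩

/-- the space `W¹_{R(θ)}(S,E)` of holomorphic functions on the
polysector `S = ∏ⱼ S(a j, b j; ρ j)` with values in a complex Banach space `E` and
finite norm `sup ‖D^N f(z)‖ ∏ⱼ R j(arg z j)^(N j) / (N!)²` is complete: every Cauchy
sequence for this norm converges, in this norm, to an element of the space. -/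
theorem W1_space_is_complete
    (n : ℕ) (a b : Fin n → ℝ) (ρ : Fin n → ℝ≥0∞)
    (hab : ∀ j, a j < b j) (hρ : ∀ j, 0 < ρ j)
    (E : Type*) [NormedAddCommGroup E] [NormedSpace ℂ E] [CompleteSpace E]
    (R : Fin n → ℝ → ℝ)
    (hRpos : ∀ j, ∀ θ ∈ Set.Ioo (a j) (b j), 0 < R j θ)
    (hRinf : ∀ j, ∀ K : Set ℝ, IsCompact K → K ⊆ Set.Ioo (a j) (b j) →
      ∃ m : ℝ, 0 < m ∧ ∀ θ ∈ K, m ≤ R j θ)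
    (F : ℕ → (Fin n → ℂ) → E)
    (hF_holo : ∀ k, DifferentiableOn ℂ (F k)
      (univ.pi fun j => Sector (a j) (b j) (ρ j)))
    (hF_mem : ∀ k, ∃ C : ℝ, WBound a b ρ R (F k) C)
    (hF_cauchy : ∀ ε : ℝ, 0 < ε → ∃ K : ℕ, ∀ k l : ℕ, K ≤ k → K ≤ l →
      WBound a b ρ R (F k - F l) ε) :
    ∃ f : (Fin n → ℂ) → E,
      DifferentiableOn ℂ f (univ.pi fun j => Sector (a j) (b j) (ρ j)) ∧
      (∃ C : ℝ, WBound a b ρ R f C) ∧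
      ∀ ε : ℝ, 0 < ε → ∃ K : ℕ, ∀ k : ℕ, K ≤ k →
        WBound a b ρ R (fun z => F k z - f z) ε := by
  have hU : IsOpen (univ.pi fun j => Sector (a j) (b j) (ρ j)) :=
    isOpen_set_pi finite_univ fun j _ => isOpen_sector _ _ _
  set U := univ.pi fun j => Sector (a j) (b j) (ρ j)
  have hcau : UniformCauchySeqOn F Filter.atTop U := by
    rw [Metric.uniformCauchySeqOn_iff]
    intro ε hε
    obtain ⟨K, hK⟩ := hF_cauchy (ε / 2) (by positivity)
    refine ⟨K, fun k hk l hl z hz => ?_⟩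
    have := (hK k l hk hl).norm_le hz
    rw [Pi.sub_apply] at this
    rw [dist_eq_norm]
    linarith
  choose! f hf using fun z (hz : z ∈ U) => cauchySeq_tendsto_of_complete (hcau.cauchySeq hz)
  have hunif : TendstoUniformlyOn F f Filter.atTop U := hcau.tendstoUniformlyOn_of_tendsto hf
  have hfd : DifferentiableOn ℂ f U := hunif.differentiableOn_complex hU hF_holo
  have hmemU : ∀ θ r : Fin n → ℝ,
      (∀ j, a j < θ j ∧ θ j < b j ∧ 0 < r j ∧ ENNReal.ofReal (r j) < ρ j) → PolarPt r θ ∈ U :=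
    fun θ r h j _ => ⟨r j, θ j, (h j).2.2.1, (h j).2.2.2, (h j).1, (h j).2.1, rfl⟩
  have hconv : ∀ ε : ℝ, 0 < ε → ∃ K : ℕ, ∀ k : ℕ, K ≤ k → WBound a b ρ R (F k - f) ε := by
    intro ε hε
    obtain ⟨K, hK⟩ := hF_cauchy ε hε
    refine ⟨K, fun k hk θ r N h => ?_⟩
    have hk' : TendstoUniformlyOn (fun l => F k - F l) (F k - f) Filter.atTop U := by
      rw [Metric.tendstoUniformlyOn_iff] at hunif ⊢
      simpa only [Pi.sub_apply, dist_sub_left] using hunif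
    have hlim := hk'.tendsto_DMulti hU (fun l => (hF_holo k).sub (hF_holo l)) N (hmemU θ r h)
    refine le_of_tendsto (hlim.norm.mul_const _) ?_
    filter_upwards [Filter.eventually_ge_atTop K] with l hl
    exact hK k l hk hl θ r N h
  refine ⟨f, hfd, ?_, hconv⟩
  obtain ⟨K, hK⟩ := hconv 1 one_pos
  obtain ⟨C, hC⟩ := hF_mem K
  refine ⟨C + 1, fun θ r N h => ?_⟩
  have h1 := hC θ r N h
  have h2 := hK K le_rfl θ r N h
  rw [DMulti_sub hU (hF_holo K) hfd N (hmemU θ r h)] at h2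
  have hR : 0 ≤ ∏ j, R j (θ j) ^ N j :=
    Finset.prod_nonneg fun j _ => pow_nonneg (hRpos j _ ⟨(h j).1, (h j).2.1⟩).le _
  have htri := norm_sub_le (DMulti N (F K) (PolarPt r θ))
    (DMulti N (F K) (PolarPt r θ) - DMulti N f (PolarPt r θ))
  rw [sub_sub_cancel] at htri
  calc _ ≤ _ := mul_le_mul_of_nonneg_right htri hR
    _ ≤ _ := by rw [add_mul, add_mul]; exact add_le_add h1 h2

end
end
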